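/- arXiv:1812.10326 — 5 statements merged into one kernel-verified Lean document; each statement's English description precedes it below -/
import Mathlib

section
/- In a matching market with contracts in which students have strict preferences monotone in contract terms, if contracts are substitutes under every college's choice function, then the student-proposing deferred acceptance algorithm converges to a stable allocation, and this allocation is weakly preferred by every student to every other stable allocation. -/
open scoped Classical

namespace MWC

variable {C S T : Type*} [DecidableEq C] [DecidableEq S] [DecidableEq T] [LinearOrder T]

/-! Contracts are triples `(college, student, term)`.  For `x : C × S × T`,
`x.1` is the college, `x.2.1` the student and `x.2.2` the contract term.
The linear order on `T` plays the role of `▷`: higher terms are better for students. -/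

variable (X : Finset (C × S × T))

/-- The contracts in `X` naming college `c` (the set `X_c`). -/
def Xc (c : C) : Finset (C × S × T) := X.filter fun x => x.1 = c

/-- A set of contracts containing at most one contract per student. -/
def IsAlloc (Y : Finset (C × S × T)) : Prop :=
  ∀ x ∈ Y, ∀ y ∈ Y, x.2.1 = y.2.1 → x = y

/-- `Ch` is a valid choice function for college `c`: from each subset of `X_c` it
chooses a subset with at most one contract per student, and it satisfies the
irrelevance of rejected contracts (IRC). -/
def IsChoice (c : C) (Ch : Finset (C × S × T) → Finset (C × S × T)) : Prop :=
  (∀ Y, Y ⊆ Xc X c → Ch Y ⊆ Y) ∧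
  (∀ Y, Y ⊆ Xc X c → IsAlloc (Ch Y)) ∧
  (∀ Y, Y ⊆ Xc X c → ∀ x ∈ Xc X c, x ∉ Y → x ∉ Ch (insert x Y) → Ch Y = Ch (insert x Y))

/-- The rejection function `R_c(Y) = Y \ Ch_c(Y)`. -/
def Rej (Ch : Finset (C × S × T) → Finset (C × S × T)) (Y : Finset (C × S × T)) :
    Finset (C × S × T) := Y \ Ch Y

/-- Contracts are substitutes under `Ch` (for college `c`). -/
def Substitutes (c : C) (Ch : Finset (C × S × T) → Finset (C × S × T)) : Prop :=
  ∀ Y, Y ⊆ Xc X c → ∀ x ∈ Xc X c, ∀ z ∈ Xc X c, x ∉ Y → z ∉ Y →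
    x ∈ Ch (insert z (insert x Y)) → x ∈ Ch (insert x Y)

/-- The law of aggregate demand for `Ch` (college `c`). -/
def LAD (c : C) (Ch : Finset (C × S × T) → Finset (C × S × T)) : Prop :=
  ∀ Z Y, Z ⊆ Y → Y ⊆ Xc X c → (Ch Z).card ≤ (Ch Y).card

/-- `Y^min`: the contracts of `Y` that give each involved student his
`▷`-worst contract among his contracts in `Y`. -/
def Ymin (Y : Finset (C × S × T)) : Finset (C × S × T) :=
  Y.filter fun y => ∀ y' ∈ Y, y'.2.1 = y.2.1 → ¬ y'.2.2 < y.2.2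

/-- `Ch` is monotone in contract terms: it always chooses from `Y^min`. -/
def MonotoneCh (c : C) (Ch : Finset (C × S × T) → Finset (C × S × T)) : Prop :=
  ∀ Y, Y ⊆ Xc X c → Ch Y ⊆ Ymin Y

/-- `us` represents a strict preference of student `s` over his contracts in `X`
together with the outside option (utility `0`), monotone in contract terms:
a higher contract term is always strictly better. -/
def IsPref (s : S) (us : C × S × T → ℤ) : Prop :=
  (∀ x ∈ X, x.2.1 = s → us x ≠ 0) ∧
  (∀ x ∈ X, ∀ y ∈ X, x.2.1 = s → y.2.1 = s → x ≠ y → us x ≠ us y) ∧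
  (∀ x ∈ X, ∀ y ∈ X, x.2.1 = s → y.2.1 = s → y.2.2 < x.2.2 → us y < us x)

/-- The utility student `s` derives from allocation `Y` (`0` = outside option). -/
def util (us : C × S × T → ℤ) (s : S) (Y : Finset (C × S × T)) : ℤ :=
  ∑ x ∈ Y.filter (fun x => x.2.1 = s), us x

/-- Individual rationality of allocation `Y` in the market `(Ch, u)`. -/
def IndivRat (Ch : C → Finset (C × S × T) → Finset (C × S × T))
    (u : S → C × S × T → ℤ) (Y : Finset (C × S × T)) : Prop :=
  (∀ c, Y.filter (fun x => x.1 = c) = Ch c (Y.filter fun x => x.1 = c)) ∧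
  ∀ y ∈ Y, 0 < u y.2.1 y

/-- College `c` together with allocation `Z` blocks allocation `Y`. -/
def Blocks (Ch : C → Finset (C × S × T) → Finset (C × S × T))
    (u : S → C × S × T → ℤ) (c : C) (Z Y : Finset (C × S × T)) : Prop :=
  Z ⊆ X ∧ IsAlloc Z ∧
  Z.filter (fun x => x.1 = c) ≠ Y.filter (fun x => x.1 = c) ∧
  Z.filter (fun x => x.1 = c) = Ch c ((Y ∪ Z).filter fun x => x.1 = c) ∧
  ∀ z ∈ Z.filter (fun x => x.1 = c), util (u z.2.1) z.2.1 Y ≤ u z.2.1 z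

/-- Stability of allocation `Y` in the market `(Ch, u)`. -/
def Stable (Ch : C → Finset (C × S × T) → Finset (C × S × T))
    (u : S → C × S × T → ℤ) (Y : Finset (C × S × T)) : Prop :=
  Y ⊆ X ∧ IsAlloc Y ∧ IndivRat Ch u Y ∧ ¬ ∃ c Z, Blocks X Ch u c Z Y

/-- The contracts proposed when `D` is the set of contracts rejected so far:
every student proposes his most preferred acceptable not-yet-rejected contract. -/
def proposals (u : S → C × S × T → ℤ) (D : Finset (C × S × T)) : Finset (C × S × T) :=
  (X \ D).filter fun x =>
    0 < u x.2.1 x ∧ ∀ y ∈ X \ D, y.2.1 = x.2.1 → u x.2.1 y ≤ u x.2.1 x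

/-- The contracts tentatively held by the colleges among the proposals `P`:
each college `c` keeps its choice from the contracts proposed to it. -/
def held (Ch : C → Finset (C × S × T) → Finset (C × S × T))
    (P : Finset (C × S × T)) : Finset (C × S × T) :=
  P.filter fun x => x ∈ Ch x.1 (P.filter fun y => y.1 = x.1)

/-- One round of the student-proposing deferred acceptance algorithm, acting on the
cumulative set of rejected contracts. -/
def step (Ch : C → Finset (C × S × T) → Finset (C × S × T))
    (u : S → C × S × T → ℤ) (D : Finset (C × S × T)) : Finset (C × S × T) :=
  D ∪ (proposals X u D \ held Ch (proposals X u D))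

/-- The outcome `DA(Ch, u)` of the student-proposing deferred acceptance algorithm
(the algorithm reaches a fixed point after at most `|X| + 1` rounds). -/
def DA (Ch : C → Finset (C × S × T) → Finset (C × S × T))
    (u : S → C × S × T → ℤ) : Finset (C × S × T) :=
  held Ch (proposals X u ((step X Ch u)^[X.card + 1] ∅))

/-- The cumulative set of contracts proposed up to round `t` of the deferred
acceptance algorithm. -/
def cumProposed (Ch : C → Finset (C × S × T) → Finset (C × S × T))
    (u : S → C × S × T → ℤ) (t : ℕ) : Finset (C × S × T) :=
  (Finset.range (t + 1)).biUnion fun r => proposals X u ((step X Ch u)^[r] ∅)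

/-- Two choice profiles are deferred-acceptance-equivalent if the DA algorithm
produces the same outcome under both, for every profile of strict preferences
monotone in contract terms. -/
def DAeq (Ch Ch' : C → Finset (C × S × T) → Finset (C × S × T)) : Prop :=
  ∀ u : S → C × S × T → ℤ, (∀ s, IsPref X s (u s)) → DA X Ch u = DA X Ch' u

/-- `Ch` is DA-stable: the DA outcome is stable for every profile of strict
preferences monotone in contract terms. -/
def DAStable (Ch : C → Finset (C × S × T) → Finset (C × S × T)) : Prop :=
  ∀ u : S → C × S × T → ℤ, (∀ s, IsPref X s (u s)) → Stable X Ch u (DA X Ch u)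

/-- Mechanism `M` is `Ch`-stable. -/
def StableMech (Ch : C → Finset (C × S × T) → Finset (C × S × T))
    (M : (S → C × S × T → ℤ) → Finset (C × S × T)) : Prop :=
  ∀ u : S → C × S × T → ℤ, (∀ s, IsPref X s (u s)) → Stable X Ch u (M u)

/-- Strategy-proofness of a mechanism on the domain of strict preferences
monotone in contract terms. -/
def SP (M : (S → C × S × T → ℤ) → Finset (C × S × T)) : Prop :=
  ∀ u u' : S → C × S × T → ℤ, (∀ s, IsPref X s (u s)) → (∀ s, IsPref X s (u' s)) →
    ∀ s : S, (∀ s', s' ≠ s → u' s' = u s') →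
      util (u s) s (M u') ≤ util (u s) s (M u)

/-- Group-strategy-proofness of a mechanism on the domain of strict preferences
monotone in contract terms. -/
def GSP (M : (S → C × S × T → ℤ) → Finset (C × S × T)) : Prop :=
  ∀ u u' : S → C × S × T → ℤ, (∀ s, IsPref X s (u s)) → (∀ s, IsPref X s (u' s)) →
    ∀ S' : Set S, S'.Nonempty → (∀ s, s ∉ S' → u' s = u s) →
      ∃ s' ∈ S', util (u s') s' (M u') ≤ util (u s') s' (M u)

/-- The sequence `L` consists of contracts in `X_c`. -/
def SeqIn (c : C) (L : List (C × S × T)) : Prop := ∀ x ∈ L, x ∈ Xc X c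

/-- The sequence `L` is generated from monotone preferences: every contract (of the
relevant college) with the same student and a strictly higher term than the `t`-th
element appears among the first `t` elements. -/
def GenMono (c : C) (L : List (C × S × T)) : Prop :=
  ∀ (t : ℕ) (ht : t < L.length), ∀ x ∈ Xc X c, x.2.1 = (L.get ⟨t, ht⟩).2.1 →
    (L.get ⟨t, ht⟩).2.2 < x.2.2 → x ∈ L.take t

/-- The sequence `L` is observable under `Ch`: the student of each next contract is
not among the students currently chosen by `Ch`. -/
def ObsSeq (Ch : Finset (C × S × T) → Finset (C × S × T)) (L : List (C × S × T)) : Prop :=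
  ∀ (t : ℕ) (ht : t < L.length), 0 < t →
    (L.get ⟨t, ht⟩).2.1 ∉ (Ch (L.take t).toFinset).image fun y => y.2.1

/-- Observable substitutability for monotone preferences. -/
def ObsSub (c : C) (Ch : Finset (C × S × T) → Finset (C × S × T)) : Prop :=
  ∀ L : List (C × S × T), SeqIn X c L → GenMono X c L → ObsSeq Ch L →
    ∀ t : ℕ, t + 1 ≤ L.length →
      Rej Ch (L.take t).toFinset ⊆ Rej Ch (L.take (t + 1)).toFinset

/-- The observable law of aggregate demand for monotone preferences. -/
def ObsLAD (c : C) (Ch : Finset (C × S × T) → Finset (C × S × T)) : Prop :=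
  ∀ L : List (C × S × T), SeqIn X c L → GenMono X c L → ObsSeq Ch L →
    ∀ t : ℕ, t + 1 ≤ L.length →
      (Ch (L.take t).toFinset).card ≤ (Ch (L.take (t + 1)).toFinset).card

/-- `Y` is an observable set under `Ch`. -/
def ObsSet (c : C) (Ch : Finset (C × S × T) → Finset (C × S × T))
    (Y : Finset (C × S × T)) : Prop :=
  ∃ L : List (C × S × T), L.Nodup ∧ L.toFinset = Y ∧ SeqIn X c L ∧
    GenMono X c L ∧ ObsSeq Ch L

/-- `Ytil` is a maximal observable subset of `Y` under `Ch`. -/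
def MaxObsSubset (c : C) (Ch : Finset (C × S × T) → Finset (C × S × T))
    (Y Ytil : Finset (C × S × T)) : Prop :=
  Ytil ⊆ Y ∧ ObsSet X c Ch Ytil ∧
    ∀ Y', ObsSet X c Ch Y' → Ytil ⊆ Y' → Y' ⊆ Y → Y' = Ytil

/-- `U(Y)`: the contracts in `X_c` that are at least as good for the involved
student as some contract of his in `Y`. -/
def Uset (c : C) (Y : Finset (C × S × T)) : Finset (C × S × T) :=
  (Xc X c).filter fun x => ∃ y ∈ Y, x.2.1 = y.2.1 ∧ (y.2.2 < x.2.2 ∨ x = y)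

/-- `Y^∨`: the (under observable substitutability unique) maximal observable subset
of `U(Y)` under `Ch`. -/
noncomputable def vee (c : C) (Ch : Finset (C × S × T) → Finset (C × S × T))
    (Y : Finset (C × S × T)) : Finset (C × S × T) :=
  if h : ∃ V, MaxObsSubset X c Ch (Uset X c Y) V then h.choose else ∅

/-- The virtual choice function
`Ch'_c(Y) = { x ∈ Y^min : x_S ∈ [Ch_c(Y^∨)]_S }`. -/
noncomputable def virtualChoice (c : C) (Ch : Finset (C × S × T) → Finset (C × S × T))
    (Y : Finset (C × S × T)) : Finset (C × S × T) :=
  (Ymin Y).filter fun x => x.2.1 ∈ (Ch (vee X c Ch Y)).image fun y => y.2.1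

theorem aux_sub (X : Finset (C × S × T)) (c : C)
    (Ch : Finset (C × S × T) → Finset (C × S × T)) (h : Substitutes X c Ch)
    (Y : Finset (C × S × T)) (x : C × S × T) (hx : x ∈ Y) (W : Finset (C × S × T)) :
    Y ∪ W ⊆ Xc X c → x ∈ Ch (Y ∪ W) → x ∈ Ch Y := by
  induction W using Finset.induction_on with
  | empty => intro _ h2; simpa using h2
  | insert a W _ ih =>
    intro h1 h2
    have hsub : Y ∪ W ⊆ Xc X c := by
      intro y hy; apply h1; simp only [Finset.mem_union, Finset.mem_insert] at hy ⊢; tauto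
    apply ih hsub
    by_cases ha : a ∈ Y ∪ W
    · have : Y ∪ insert a W = Y ∪ W := by
        rw [Finset.union_insert, Finset.insert_eq_of_mem ha]
      rwa [this] at h2
    · have hxW : x ∈ Y ∪ W := Finset.mem_union_left _ hx
      have hax : a ≠ x := fun e => ha (e ▸ hxW)
      have haX : a ∈ Xc X c := h1 (by simp)
      have e1 : insert x ((Y ∪ W).erase x) = Y ∪ W := Finset.insert_erase hxW
      have := h ((Y ∪ W).erase x) ((Finset.erase_subset _ _).trans hsub) x (hsub hxW) a haX
        (Finset.notMem_erase _ _) (fun h' => ha (Finset.mem_of_mem_erase h'))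
      rw [e1, ← Finset.union_insert] at this
      exact this h2

theorem aux_sub' (X : Finset (C × S × T)) (c : C)
    (Ch : Finset (C × S × T) → Finset (C × S × T)) (h : Substitutes X c Ch)
    (Y Y' : Finset (C × S × T)) (x : C × S × T) (hx : x ∈ Y) (hY : Y ⊆ Y')
    (hY' : Y' ⊆ Xc X c) (h2 : x ∈ Ch Y') : x ∈ Ch Y := by
  have e : Y ∪ Y' = Y' := Finset.union_eq_right.2 hY
  exact aux_sub X c Ch h Y x hx Y' (e.symm ▸ hY') (e.symm ▸ h2)

theorem aux_irc (X : Finset (C × S × T)) (c : C)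
    (Ch : Finset (C × S × T) → Finset (C × S × T)) (h : IsChoice X c Ch)
    (Y : Finset (C × S × T)) (W : Finset (C × S × T)) :
    Y ∪ W ⊆ Xc X c → Ch (Y ∪ W) ⊆ Y → Ch Y = Ch (Y ∪ W) := by
  induction W using Finset.induction_on with
  | empty => intro _ h2; simp
  | insert a W _ ih =>
    intro h1 h2
    have hsub : Y ∪ W ⊆ Xc X c := by
      intro y hy; apply h1; simp only [Finset.mem_union, Finset.mem_insert] at hy ⊢; tauto
    by_cases ha : a ∈ Y ∪ W
    · have : Y ∪ insert a W = Y ∪ W := by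
        rw [Finset.union_insert, Finset.insert_eq_of_mem ha]
      rw [this] at h2 ⊢
      exact ih hsub h2
    · have haX : a ∈ Xc X c := h1 (by simp)
      rw [Finset.union_insert] at h2 ⊢
      have e := h.2.2 (Y ∪ W) hsub a haX ha (fun h' => ha (Finset.mem_union_left _ (h2 h')))
      rw [← e] at h2 ⊢
      exact ih hsub h2

theorem aux_irc' (X : Finset (C × S × T)) (c : C)
    (Ch : Finset (C × S × T) → Finset (C × S × T)) (h : IsChoice X c Ch)
    (Y Y' : Finset (C × S × T)) (hY : Y ⊆ Y')
    (hY' : Y' ⊆ Xc X c) (h2 : Ch Y' ⊆ Y) : Ch Y = Ch Y' := by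
  have e : Y ∪ Y' = Y' := Finset.union_eq_right.2 hY
  have := aux_irc X c Ch h Y Y' (e.symm ▸ hY') (e.symm ▸ h2)
  rwa [e] at this

theorem filter_sub_Xc (X Y : Finset (C × S × T)) (hY : Y ⊆ X) (c : C) :
    Y.filter (fun x => x.1 = c) ⊆ Xc X c := Finset.filter_subset_filter _ hY

theorem prop_sub (X : Finset (C × S × T)) (u : S → C × S × T → ℤ) (D : Finset (C × S × T)) :
    proposals X u D ⊆ X :=
  (Finset.filter_subset _ _).trans Finset.sdiff_subset

theorem mem_prop (X : Finset (C × S × T)) (u : S → C × S × T → ℤ) (D : Finset (C × S × T))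
    (x : C × S × T) : x ∈ proposals X u D ↔ (x ∈ X ∧ x ∉ D) ∧
      0 < u x.2.1 x ∧ ∀ y, y ∈ X → y ∉ D → y.2.1 = x.2.1 → u x.2.1 y ≤ u x.2.1 x := by
  simp [proposals]

theorem exists_prop (X : Finset (C × S × T)) (u : S → C × S × T → ℤ) (D : Finset (C × S × T))
    (z : C × S × T) (hz : z ∈ X) (hD : z ∉ D) (hp : 0 < u z.2.1 z) :
    ∃ p ∈ proposals X u D, p.2.1 = z.2.1 ∧ u z.2.1 z ≤ u z.2.1 p := by
  obtain ⟨p, hpm, hmax⟩ := ((X \ D).filter (fun y => y.2.1 = z.2.1)).exists_max_image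
    (fun y => u z.2.1 y) ⟨z, by simp [hz, hD]⟩
  simp only [Finset.mem_filter, Finset.mem_sdiff] at hpm hmax
  have h1 := hmax z ⟨⟨hz, hD⟩, rfl⟩
  refine ⟨p, ?_, hpm.2, h1⟩
  rw [mem_prop, hpm.2]
  exact ⟨hpm.1, by omega, fun y hy hyD e => hmax y ⟨⟨hy, hyD⟩, e⟩⟩

theorem prop_alloc (X : Finset (C × S × T)) (u : S → C × S × T → ℤ) (D : Finset (C × S × T))
    (hu : ∀ s, IsPref X s (u s)) : IsAlloc (proposals X u D) := by
  intro x hx y hy e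
  rw [mem_prop] at hx hy
  by_contra hne
  have h1 := hx.2.2 y hy.1.1 hy.1.2 e.symm
  have h2 := hy.2.2 x hx.1.1 hx.1.2 e
  rw [← e] at h2
  exact (hu x.2.1).2.1 x hx.1.1 y hy.1.1 rfl e.symm hne (le_antisymm h2 h1)

theorem util_mem (us : C × S × T → ℤ) (Y : Finset (C × S × T)) (hY : IsAlloc Y)
    (y : C × S × T) (hy : y ∈ Y) (s : S) (hs : y.2.1 = s) : util us s Y = us y := by
  have : Y.filter (fun x => x.2.1 = s) = {y} := by
    ext x
    simp only [Finset.mem_filter, Finset.mem_singleton]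
    constructor
    · rintro ⟨h1, h2⟩; exact hY x h1 y hy (h2.trans hs.symm)
    · rintro rfl; exact ⟨hy, hs⟩
  rw [util, this, Finset.sum_singleton]

theorem util_none (us : C × S × T → ℤ) (Y : Finset (C × S × T)) (s : S)
    (h : ∀ y ∈ Y, y.2.1 ≠ s) : util us s Y = 0 := by
  rw [util, Finset.filter_false_of_mem h, Finset.sum_empty]

theorem held_mem (Ch : C → Finset (C × S × T) → Finset (C × S × T))
    (P : Finset (C × S × T)) (x : C × S × T) :
    x ∈ held Ch P ↔ x ∈ P ∧ x ∈ Ch x.1 (P.filter fun y => y.1 = x.1) := by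
  simp [held]

/-- Invariant of the algorithm: rejected contracts stay rejected from the cumulative offers. -/
def Inv (X : Finset (C × S × T)) (Ch : C → Finset (C × S × T) → Finset (C × S × T))
    (u : S → C × S × T → ℤ) (D : Finset (C × S × T)) : Prop :=
  D ⊆ X ∧ ∀ c, ∀ x ∈ D, x ∉ Ch c ((D ∪ proposals X u D).filter fun y => y.1 = c)

theorem Inv.eq {X : Finset (C × S × T)} {Ch : C → Finset (C × S × T) → Finset (C × S × T)}
    {u : S → C × S × T → ℤ} {D : Finset (C × S × T)} (hCh : ∀ c, IsChoice X c (Ch c))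
    (h : Inv X Ch u D) (c : C) :
    Ch c ((D ∪ proposals X u D).filter fun y => y.1 = c) ⊆
      (proposals X u D).filter fun y => y.1 = c := by
  intro x hx
  have h1 := (hCh c).1 _ (filter_sub_Xc X _ (Finset.union_subset h.1 (prop_sub X u D)) c) hx
  have h2 : x ∉ D := fun hD => h.2 c x hD hx
  simp only [Finset.mem_filter, Finset.mem_union] at h1 ⊢
  tauto

theorem inv_step (X : Finset (C × S × T)) (Ch : C → Finset (C × S × T) → Finset (C × S × T))
    (u : S → C × S × T → ℤ) (hCh : ∀ c, IsChoice X c (Ch c))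
    (hsub : ∀ c, Substitutes X c (Ch c)) (D : Finset (C × S × T))
    (h : Inv X Ch u D) : Inv X Ch u (step X Ch u D) := by
  have hP := prop_sub X u D
  have hD' : step X Ch u D ⊆ X := Finset.union_subset h.1 (Finset.sdiff_subset.trans hP)
  refine ⟨hD', ?_⟩
  intro c x hx hxc
  have hAA : D ∪ proposals X u D ⊆ step X Ch u D ∪ proposals X u (step X Ch u D) := by
    intro y hy
    by_cases hyD : y ∈ step X Ch u D
    · exact Finset.mem_union_left _ hyD
    · apply Finset.mem_union_right
      have hyP : y ∈ proposals X u D := by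
        rcases Finset.mem_union.1 hy with h1 | h1
        · exact absurd (Finset.mem_union_left _ h1) hyD
        · exact h1
      have hm := (mem_prop X u D y).1 hyP
      rw [mem_prop]
      exact ⟨⟨hm.1.1, hyD⟩, hm.2.1, fun z hz hzD e =>
        hm.2.2 z hz (fun h' => hzD (Finset.mem_union_left _ h')) e⟩
  have hA'X := filter_sub_Xc X _ (Finset.union_subset hD' (prop_sub X u (step X Ch u D))) c
  have hAX := filter_sub_Xc X _ (Finset.union_subset h.1 hP) c
  have hxc1 : x.1 = c := (Finset.mem_filter.1 ((hCh c).1 _ hA'X hxc)).2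
  have hxA : x ∈ D ∪ proposals X u D := by
    rcases Finset.mem_union.1 hx with h1 | h1
    · exact Finset.mem_union_left _ h1
    · exact Finset.mem_union_right _ (Finset.mem_sdiff.1 h1).1
  have h3 := aux_sub' X c (Ch c) (hsub c) _ _ x (Finset.mem_filter.2 ⟨hxA, hxc1⟩)
    (Finset.filter_subset_filter _ hAA) hA'X hxc
  rcases Finset.mem_union.1 hx with h1 | h1
  · exact h.2 c x h1 h3
  · have e := aux_irc' X c (Ch c) (hCh c) _ _
      (Finset.filter_subset_filter _ Finset.subset_union_right) hAX (h.eq hCh c)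
    rw [← e] at h3
    rw [Finset.mem_sdiff, held_mem] at h1
    subst hxc1
    exact h1.2 ⟨h1.1, h3⟩

theorem inv_iter (X : Finset (C × S × T)) (Ch : C → Finset (C × S × T) → Finset (C × S × T))
    (u : S → C × S × T → ℤ) (hCh : ∀ c, IsChoice X c (Ch c))
    (hsub : ∀ c, Substitutes X c (Ch c)) (n : ℕ) : Inv X Ch u ((step X Ch u)^[n] ∅) := by
  induction n with
  | zero => simp [Inv]
  | succ n ih => rw [Function.iterate_succ_apply']; exact inv_step X Ch u hCh hsub _ ih

theorem iter_card (X : Finset (C × S × T)) (Ch : C → Finset (C × S × T) → Finset (C × S × T))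
    (u : S → C × S × T → ℤ) (n : ℕ) :
    step X Ch u ((step X Ch u)^[n] ∅) = (step X Ch u)^[n] ∅ ∨
      n ≤ ((step X Ch u)^[n] ∅).card := by
  induction n with
  | zero => simp
  | succ n ih =>
    rw [Function.iterate_succ_apply']
    by_cases hfix : step X Ch u ((step X Ch u)^[n] ∅) = (step X Ch u)^[n] ∅
    · left; rw [hfix, hfix]
    · right
      have h1 := ih.resolve_left hfix
      have : ((step X Ch u)^[n] ∅) ⊂ step X Ch u ((step X Ch u)^[n] ∅) :=
        Finset.ssubset_iff_subset_ne.2 ⟨Finset.subset_union_left, Ne.symm hfix⟩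
      have := Finset.card_lt_card this
      omega

theorem da_eq (X : Finset (C × S × T)) (Ch : C → Finset (C × S × T) → Finset (C × S × T))
    (u : S → C × S × T → ℤ) (hCh : ∀ c, IsChoice X c (Ch c))
    (hsub : ∀ c, Substitutes X c (Ch c)) :
    held Ch (proposals X u ((step X Ch u)^[X.card + 1] ∅)) =
      proposals X u ((step X Ch u)^[X.card + 1] ∅) := by
  have hI := inv_iter X Ch u hCh hsub (X.card + 1)
  have hfix := (iter_card X Ch u (X.card + 1)).resolve_right (by
    have := Finset.card_le_card hI.1
    omega)
  generalize (step X Ch u)^[X.card + 1] ∅ = D at *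
  apply Finset.Subset.antisymm (Finset.filter_subset _ _)
  intro x hx
  by_contra hn
  have : x ∈ step X Ch u D := Finset.mem_union_right _ (Finset.mem_sdiff.2 ⟨hx, hn⟩)
  rw [hfix] at this
  exact ((mem_prop X u D x).1 hx).1.2 this

theorem stable_of_inv (X : Finset (C × S × T))
    (Ch : C → Finset (C × S × T) → Finset (C × S × T))
    (u : S → C × S × T → ℤ) (hCh : ∀ c, IsChoice X c (Ch c))
    (hu : ∀ s, IsPref X s (u s)) (D : Finset (C × S × T)) (h : Inv X Ch u D)
    (hh : held Ch (proposals X u D) = proposals X u D) :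
    Stable X Ch u (proposals X u D) := by
  have hP := prop_sub X u D
  have hal := prop_alloc X u D hu
  have hIR : ∀ c, (proposals X u D).filter (fun x => x.1 = c) =
      Ch c ((proposals X u D).filter fun x => x.1 = c) := by
    intro c
    apply Finset.Subset.antisymm
    · intro x hx
      obtain ⟨h1, rfl⟩ := Finset.mem_filter.1 hx
      rw [← hh] at h1
      exact ((held_mem _ _ _).1 h1).2
    · exact (hCh c).1 _ (filter_sub_Xc X _ hP c)
  refine ⟨hP, hal, ⟨hIR, fun y hy => ((mem_prop X u D y).1 hy).2.1⟩, ?_⟩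
  rintro ⟨c, Z, hZX, -, hne, hZ, hpref⟩
  apply hne
  have hAX := filter_sub_Xc X _ (Finset.union_subset h.1 hP) c
  have e1 := aux_irc' X c (Ch c) (hCh c) _ _
      (Finset.filter_subset_filter _ Finset.subset_union_right) hAX (h.eq hCh c)
  have hsubA : (proposals X u D ∪ Z).filter (fun x => x.1 = c) ⊆
      (D ∪ proposals X u D).filter (fun x => x.1 = c) := by
    intro z hz
    obtain ⟨h1, hzc⟩ := Finset.mem_filter.1 hz
    refine Finset.mem_filter.2 ⟨?_, hzc⟩
    rcases Finset.mem_union.1 h1 with h1 | h1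
    · exact Finset.mem_union_right _ h1
    by_contra hcon
    rw [Finset.mem_union, not_or] at hcon
    have hp := hpref z (Finset.mem_filter.2 ⟨h1, hzc⟩)
    by_cases hex : ∃ p ∈ proposals X u D, p.2.1 = z.2.1
    · obtain ⟨p, hpP, hps⟩ := hex
      rw [util_mem _ _ hal p hpP _ hps] at hp
      have hpm := (mem_prop X u D p).1 hpP
      have h2 := hpm.2.2 z (hZX h1) hcon.1 hps.symm
      rw [hps] at h2
      refine (hu z.2.1).2.1 z (hZX h1) p hpm.1.1 rfl hps ?_ (le_antisymm h2 hp)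
      rintro rfl
      exact hcon.2 hpP
    · push Not at hex
      rw [util_none _ _ _ hex] at hp
      have h0 := (hu z.2.1).1 z (hZX h1) rfl
      obtain ⟨p, hpP, hps, -⟩ := exists_prop X u D z (hZX h1) hcon.1 (by omega)
      exact hex p hpP hps
  have e2 := aux_irc' X c (Ch c) (hCh c) _ _ hsubA hAX
    ((h.eq hCh c).trans (Finset.filter_subset_filter _ Finset.subset_union_left))
  rw [hZ, e2, ← e1, ← hIR c]

theorem stable_disj (X : Finset (C × S × T))
    (Ch : C → Finset (C × S × T) → Finset (C × S × T))
    (u : S → C × S × T → ℤ) (hCh : ∀ c, IsChoice X c (Ch c))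
    (hsub : ∀ c, Substitutes X c (Ch c))
    (Z : Finset (C × S × T)) (hZ : Stable X Ch u Z)
    (D : Finset (C × S × T)) (h : ∀ z ∈ Z, z ∉ D) : ∀ z ∈ Z, z ∉ step X Ch u D := by
  intro x hxZ hx
  have hP := prop_sub X u D
  obtain ⟨hZX, hZal, ⟨-, hZpos⟩, hblock⟩ := hZ
  have hx1 := (Finset.mem_union.1 hx).resolve_left (h x hxZ)
  rw [Finset.mem_sdiff, held_mem] at hx1
  obtain ⟨hxP, hxn⟩ := hx1
  obtain ⟨c, hc⟩ : ∃ c, c = x.1 := ⟨_, rfl⟩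
  rw [← hc] at hxn
  have hAX := filter_sub_Xc X _ (Finset.union_subset hZX hP) c
  obtain ⟨W, hWdef⟩ : ∃ W, W = Ch c ((Z ∪ proposals X u D).filter fun y => y.1 = c) := ⟨_, rfl⟩
  have hWA : W ⊆ (Z ∪ proposals X u D).filter fun y => y.1 = c := hWdef ▸ (hCh c).1 _ hAX
  have hWc : W.filter (fun y => y.1 = c) = W :=
    Finset.filter_true_of_mem fun y hy => (Finset.mem_filter.1 (hWA hy)).2
  apply hblock
  refine ⟨c, W, ?_, ?_, ?_, ?_, ?_⟩
  · exact (hWA.trans hAX).trans (Finset.filter_subset _ _)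
  · rw [hWdef]; exact (hCh c).2.1 _ hAX
  · rw [hWc]
    intro e
    have hxW : x ∈ W := e ▸ Finset.mem_filter.2 ⟨hxZ, hc.symm⟩
    rw [hWdef] at hxW
    exact hxn ⟨hxP, aux_sub' X c (Ch c) (hsub c) _ _ x (Finset.mem_filter.2 ⟨hxP, hc.symm⟩)
      (Finset.filter_subset_filter _ Finset.subset_union_right) hAX hxW⟩
  · rw [hWc]
    have hs : (Z ∪ W).filter (fun y => y.1 = c) ⊆
        (Z ∪ proposals X u D).filter (fun y => y.1 = c) := by
      intro y hy
      obtain ⟨h1, h2⟩ := Finset.mem_filter.1 hy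
      rcases Finset.mem_union.1 h1 with h1 | h1
      · exact Finset.mem_filter.2 ⟨Finset.mem_union_left _ h1, h2⟩
      · exact hWA h1
    rw [aux_irc' X c (Ch c) (hCh c) _ _ hs hAX, hWdef]
    rw [← hWdef]
    intro y hy
    exact Finset.mem_filter.2 ⟨Finset.mem_union_right _ hy, (Finset.mem_filter.1 (hWA hy)).2⟩
  · rw [hWc]
    intro w hw
    rcases Finset.mem_union.1 (Finset.mem_filter.1 (hWA hw)).1 with h1 | h1
    · rw [util_mem _ _ hZal w h1 _ rfl]
    · have hm := (mem_prop X u D w).1 h1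
      by_cases hex : ∃ z ∈ Z, z.2.1 = w.2.1
      · obtain ⟨z, hz, hzs⟩ := hex
        rw [util_mem _ _ hZal z hz _ hzs]
        exact hm.2.2 z (hZX hz) (h z hz) hzs
      · push Not at hex
        rw [util_none _ _ _ hex]
        exact hm.2.1.le

/-- with monotone strict student preferences, if contracts are
substitutes for every college, the DA algorithm converges to a stable allocation
which every student weakly prefers to every other stable allocation. -/
theorem statement_0 [Fintype C] [Fintype S] [Fintype T]
    (X : Finset (C × S × T)) (Ch : C → Finset (C × S × T) → Finset (C × S × T))
    (u : S → C × S × T → ℤ)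
    (hCh : ∀ c, IsChoice X c (Ch c))
    (hsub : ∀ c, Substitutes X c (Ch c))
    (hu : ∀ s, IsPref X s (u s)) :
    Stable X Ch u (DA X Ch u) ∧
      ∀ Z, Stable X Ch u Z → ∀ s : S, util (u s) s Z ≤ util (u s) s (DA X Ch u) := by
  have hI := inv_iter X Ch u hCh hsub (X.card + 1)
  have hh := da_eq X Ch u hCh hsub
  have hdisj : ∀ Z, Stable X Ch u Z → ∀ n, ∀ z ∈ Z, z ∉ (step X Ch u)^[n] ∅ := by
    intro Z hZ n
    induction n with
    | zero => simp
    | succ n ih =>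
      rw [Function.iterate_succ_apply']
      exact stable_disj X Ch u hCh hsub Z hZ _ ih
  rw [DA, hh]
  refine ⟨stable_of_inv X Ch u hCh hu _ hI hh, ?_⟩
  intro Z hZ s
  have hd := hdisj Z hZ (X.card + 1)
  generalize (step X Ch u)^[X.card + 1] ∅ = D at *
  have hal := prop_alloc X u D hu
  by_cases hex : ∃ z ∈ Z, z.2.1 = s
  · obtain ⟨z, hz, rfl⟩ := hex
    obtain ⟨p, hp, hps, hle⟩ := exists_prop X u D z (hZ.1 hz) (hd z hz) (hZ.2.2.1.2 z hz)
    rw [util_mem _ _ hZ.2.1 z hz _ rfl, util_mem _ _ hal p hp _ hps]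
    exact hle
  · push Not at hex
    rw [util_none _ _ _ hex]
    apply Finset.sum_nonneg
    intro p hp
    obtain ⟨h1, rfl⟩ := Finset.mem_filter.1 hp
    exact ((mem_prop X u D p).1 h1).2.1.le

end MWC
end

section
/- In a matching market with contracts in which students have strict preferences monotone in contract terms, if contracts are substitutes under every college's choice function and every college's choice function satisfies the law of aggregate demand, then the set of students who are matched (sign some contract) is the same in every stable allocation, and each college signs the same number of contracts in every stable allocation. -/
open scoped Classical

namespace MWC

variable {C S T : Type*} [DecidableEq C] [DecidableEq S] [DecidableEq T] [LinearOrder T]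

/-! Contracts are triples `(college, student, term)`.  For `x : C × S × T`,
`x.1` is the college, `x.2.1` the student and `x.2.2` the contract term.
The linear order on `T` plays the role of `▷`: higher terms are better for students. -/

variable (X : Finset (C × S × T))

theorem substitutes_mono (X : Finset (C × S × T)) (c : C)
    (Ch : Finset (C × S × T) → Finset (C × S × T)) (hsub : Substitutes X c Ch)
    (A D : Finset (C × S × T)) (x : C × S × T) (hxA : x ∈ A)
    (hA : A ∪ D ⊆ Xc X c) (hx : x ∈ Ch (A ∪ D)) : x ∈ Ch A := by
  induction D using Finset.induction_on with
  | empty => simpa using hx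
  | insert z D hz ih =>
    have hAD : A ∪ D ⊆ Xc X c :=
      (Finset.union_subset_union_right (Finset.subset_insert z D)).trans hA
    apply ih hAD
    rw [Finset.union_insert] at hx hA
    by_cases hzA : z ∈ A ∪ D
    · rwa [Finset.insert_eq_of_mem hzA] at hx
    · have hxz : x ∈ A ∪ D := Finset.mem_union_left _ hxA
      have hne : x ≠ z := fun h => hzA (h ▸ hxz)
      have key := hsub ((A ∪ D).erase x) ((Finset.erase_subset _ _).trans hAD) x (hAD hxz) z
        (hA (Finset.mem_insert_self _ _)) (Finset.notMem_erase _ _)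
        (fun h => hzA (Finset.mem_of_mem_erase h))
      rw [Finset.insert_erase hxz] at key
      exact key hx

theorem util_eq (us : C × S × T → ℤ) (Z : Finset (C × S × T)) (hZ : IsAlloc Z)
    (z : C × S × T) (hz : z ∈ Z) : util us z.2.1 Z = us z := by
  have : Z.filter (fun x => x.2.1 = z.2.1) = {z} := by
    ext y
    simp only [Finset.mem_filter, Finset.mem_singleton]
    constructor
    · rintro ⟨h1, h2⟩
      exact hZ y h1 z hz h2
    · rintro rfl
      exact ⟨hz, rfl⟩
  rw [util, this, Finset.sum_singleton]

theorem stable_better (X : Finset (C × S × T))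
    (Ch : C → Finset (C × S × T) → Finset (C × S × T)) (u : S → C × S × T → ℤ)
    (hCh : ∀ c, IsChoice X c (Ch c)) (Z : Finset (C × S × T)) (hZ : Stable X Ch u Z)
    (x : C × S × T) (hxX : x ∈ X) (hx0 : 0 < u x.2.1 x) (hxZ : x ∉ Z)
    (hx : x ∈ Ch x.1 (insert x (Z.filter fun y => y.1 = x.1))) :
    ∃ z ∈ Z, z.2.1 = x.2.1 ∧ u x.2.1 x < u x.2.1 z := by
  by_contra! hno
  obtain ⟨hZX, hZA, hIR, hnb⟩ := hZ
  obtain ⟨h1, h2, -⟩ := hCh x.1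
  have hsubX : insert x (Z.filter fun y => y.1 = x.1) ⊆ Xc X x.1 := by
    intro y hy
    simp only [Finset.mem_insert, Finset.mem_filter, Xc] at hy ⊢
    rcases hy with rfl | ⟨h, h'⟩
    · exact ⟨hxX, rfl⟩
    · exact ⟨hZX h, h'⟩
  have hW := h1 _ hsubX
  have hWA := h2 _ hsubX
  generalize hWd : Ch x.1 (insert x (Z.filter fun y => y.1 = x.1)) = W at *
  have hWX : W ⊆ Xc X x.1 := hW.trans hsubX
  have hWf : W.filter (fun y => y.1 = x.1) = W :=
    Finset.filter_true_of_mem fun y hy => (Finset.mem_filter.1 (hWX hy)).2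
  refine hnb ⟨x.1, W, fun y hy => (Finset.mem_filter.1 (hWX hy)).1, hWA, ?_, ?_, ?_⟩
  · intro h
    rw [hWf] at h
    rw [h] at hx
    exact hxZ (Finset.mem_filter.1 hx).1
  · rw [hWf, ← hWd]
    congr 1
    ext y
    simp only [Finset.mem_insert, Finset.mem_filter, Finset.mem_union, hWd]
    constructor
    · rintro (rfl | h)
      · exact ⟨Or.inr hx, rfl⟩
      · exact ⟨Or.inl h.1, h.2⟩
    · rintro ⟨h | h, h'⟩
      · exact Or.inr ⟨h, h'⟩
      · simpa using hW h
  · intro w hw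
    rw [hWf] at hw
    have hw' := hW hw
    simp only [Finset.mem_insert, Finset.mem_filter] at hw'
    rcases hw' with rfl | ⟨h, -⟩
    · by_cases hz : ∃ z ∈ Z, z.2.1 = w.2.1
      · obtain ⟨z, hz, hzs⟩ := hz
        rw [← hzs, util_eq _ Z hZA z hz, hzs]
        exact hno z hz hzs
      · have : Z.filter (fun y => y.2.1 = w.2.1) = ∅ :=
          Finset.filter_false_of_mem fun y hy h => hz ⟨y, hy, h⟩
        rw [util, this, Finset.sum_empty]
        exact hx0.le
    · exact (util_eq _ Z hZA w h).le

/-- rural hospitals theorem under substitutes + LAD. -/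
theorem statement_1 [Fintype C] [Fintype S] [Fintype T]
    (X : Finset (C × S × T)) (Ch : C → Finset (C × S × T) → Finset (C × S × T))
    (u : S → C × S × T → ℤ)
    (hCh : ∀ c, IsChoice X c (Ch c))
    (hsub : ∀ c, Substitutes X c (Ch c))
    (hlad : ∀ c, LAD X c (Ch c))
    (hu : ∀ s, IsPref X s (u s)) :
    ∀ Y Z, Stable X Ch u Y → Stable X Ch u Z →
      (Y.image (fun x => x.2.1) = Z.image fun x => x.2.1) ∧
      ∀ c : C, (Y.filter fun x => x.1 = c).card = (Z.filter fun x => x.1 = c).card := by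
  intro Y Z hY hZ
  -- the choice of each college from the union of the two allocations
  let K : C → Finset (C × S × T) := fun c => Ch c ((Y ∪ Z).filter fun x => x.1 = c)
  have hsubX : ∀ c, (Y ∪ Z).filter (fun x => x.1 = c) ⊆ Xc X c := fun c =>
    Finset.filter_subset_filter _ (Finset.union_subset hY.1 hZ.1)
  have hK1 : ∀ c, K c ⊆ (Y ∪ Z).filter fun x => x.1 = c := fun c => (hCh c).1 _ (hsubX c)
  -- a chosen contract outside a stable allocation is worse than that allocation
  have key : ∀ V W : Finset (C × S × T), Stable X Ch u V → Stable X Ch u W → V ∪ W = Y ∪ Z →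
      ∀ c, ∀ x ∈ K c, x ∉ W → ∃ z ∈ W, z.2.1 = x.2.1 ∧ u x.2.1 x < u x.2.1 z := by
    intro V W hV hW hVW c x hx hxW
    have hx' := Finset.mem_filter.1 (hK1 c hx)
    obtain ⟨hxu, rfl⟩ := hx'
    rw [← hVW] at hxu
    have hxV : x ∈ V := (Finset.mem_union.1 hxu).resolve_right hxW
    refine stable_better X Ch u hCh W hW x (hV.1 hxV) (hV.2.2.1.2 x hxV) hxW ?_
    have he : insert x (W.filter fun y => y.1 = x.1) ∪ ((Y ∪ Z).filter fun y => y.1 = x.1)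
        = (Y ∪ Z).filter fun y => y.1 = x.1 := by
      apply Finset.union_eq_right.2
      intro y hy
      rw [← hVW]
      simp only [Finset.mem_insert, Finset.mem_filter, Finset.mem_union] at hy ⊢
      rcases hy with rfl | h
      · exact ⟨Or.inl hxV, rfl⟩
      · exact ⟨Or.inr h.1, h.2⟩
    apply substitutes_mono X x.1 (Ch x.1) (hsub x.1) _ ((Y ∪ Z).filter fun y => y.1 = x.1) x
      (Finset.mem_insert_self _ _)
    · rw [he]
      exact hsubX _
    · rw [he]
      exact hx
  have kZ := key Y Z hY hZ rfl
  have kY := key Z Y hZ hY (Finset.union_comm _ _)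
  let KK : Finset (C × S × T) := Finset.univ.biUnion K
  have hKK : ∀ x ∈ KK, ∃ c, x ∈ K c := fun x hx => by simpa [KK] using hx
  have hinj : Set.InjOn (fun x : C × S × T => x.2.1) (KK : Set (C × S × T)) := by
    intro x hx y hy hxy
    obtain ⟨c, hxc⟩ := hKK x hx
    obtain ⟨d, hyd⟩ := hKK y hy
    have hxu := Finset.mem_union.1 (Finset.mem_filter.1 (hK1 c hxc)).1
    have hyu := Finset.mem_union.1 (Finset.mem_filter.1 (hK1 d hyd)).1
    have hxy' : x.2.1 = y.2.1 := hxy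
    have aY := hY.2.1
    have aZ := hZ.2.1
    by_cases h1 : x ∈ Y <;> by_cases h2 : y ∈ Y
    · exact aY x h1 y h2 hxy'
    · by_cases h3 : x ∈ Z
      · exact aZ x h3 y (hyu.resolve_left h2) hxy'
      · obtain ⟨z, hz, hzs, hlt⟩ := kZ c x hxc h3
        obtain ⟨w, hw, hws, hlt'⟩ := kY d y hyd h2
        obtain rfl := aZ z hz y (hyu.resolve_left h2) (hzs.trans hxy')
        obtain rfl := aY w hw x h1 (hws.trans hxy'.symm)
        rw [hws] at hlt
        omega
    · by_cases h3 : y ∈ Z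
      · exact aZ x (hxu.resolve_left h1) y h3 hxy'
      · obtain ⟨z, hz, hzs, hlt⟩ := kZ d y hyd h3
        obtain ⟨w, hw, hws, hlt'⟩ := kY c x hxc h1
        obtain rfl := aZ z hz x (hxu.resolve_left h1) (hzs.trans hxy'.symm)
        obtain rfl := aY w hw y h2 (hws.trans hxy')
        rw [hzs] at hlt'
        omega
    · exact aZ x (hxu.resolve_left h1) y (hyu.resolve_left h2) hxy'
  have himY : KK.image (fun x => x.2.1) ⊆ Y.image fun x => x.2.1 := by
    intro s hs
    obtain ⟨x, hx, rfl⟩ := Finset.mem_image.1 hs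
    obtain ⟨c, hxc⟩ := hKK x hx
    by_cases h : x ∈ Y
    · exact Finset.mem_image.2 ⟨x, h, rfl⟩
    · obtain ⟨z, hz, hzs, -⟩ := kY c x hxc h
      exact Finset.mem_image.2 ⟨z, hz, hzs⟩
  have himZ : KK.image (fun x => x.2.1) ⊆ Z.image fun x => x.2.1 := by
    intro s hs
    obtain ⟨x, hx, rfl⟩ := Finset.mem_image.1 hs
    obtain ⟨c, hxc⟩ := hKK x hx
    by_cases h : x ∈ Z
    · exact Finset.mem_image.2 ⟨x, h, rfl⟩
    · obtain ⟨z, hz, hzs, -⟩ := kZ c x hxc h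
      exact Finset.mem_image.2 ⟨z, hz, hzs⟩
  have hKcard : (KK.image fun x => x.2.1).card = ∑ c, (K c).card := by
    rw [Finset.card_image_of_injOn hinj]
    apply Finset.card_biUnion
    intro c _ d _ hcd
    refine Finset.disjoint_left.2 ?_
    intro x hx hx'
    exact hcd ((Finset.mem_filter.1 (hK1 c hx)).2.symm.trans (Finset.mem_filter.1 (hK1 d hx')).2)
  have main : ∀ V : Finset (C × S × T), Stable X Ch u V → V ⊆ Y ∪ Z →
      KK.image (fun x => x.2.1) ⊆ (V.image fun x => x.2.1) →
      KK.image (fun x => x.2.1) = (V.image fun x => x.2.1) ∧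
      ∀ c, (V.filter fun x => x.1 = c).card = (K c).card := by
    intro V hV hVs him
    have hle : ∀ c, (V.filter fun x => x.1 = c).card ≤ (K c).card := by
      intro c
      have h := hlad c (V.filter fun x => x.1 = c) ((Y ∪ Z).filter fun x => x.1 = c)
        (Finset.filter_subset_filter _ hVs) (hsubX c)
      rw [← hV.2.2.1.1 c] at h
      exact h
    have hVc : (V.image fun x => x.2.1).card = ∑ c, (V.filter fun x => x.1 = c).card := by
      rw [Finset.card_image_of_injOn (fun x hx y hy h => hV.2.1 x hx y hy h)]
      exact Finset.card_eq_sum_card_fiberwise (fun x _ => Finset.mem_coe.2 (Finset.mem_univ _))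
    have hsum : ∑ c, (V.filter fun x => x.1 = c).card ≤ ∑ c, (K c).card :=
      Finset.sum_le_sum fun c _ => hle c
    have himc := Finset.card_le_card him
    refine ⟨Finset.eq_of_subset_of_card_le him (by omega), fun c => ?_⟩
    exact (Finset.sum_eq_sum_iff_of_le (fun c _ => hle c)).1 (by omega) c (Finset.mem_univ c)
  obtain ⟨e1, f1⟩ := main Y hY Finset.subset_union_left himY
  obtain ⟨e2, f2⟩ := main Z hZ Finset.subset_union_right himZ
  exact ⟨e1.symm.trans e2, fun c => (f1 c).trans (f2 c).symm⟩

end MWC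
end

section
/- If contracts are observable substitutes for monotone preferences under a college's choice function Ch_c, then every set Y ⊆ X_c has a unique maximal observable subset under Ch_c. -/
open scoped Classical

namespace MWC

variable {C S T : Type*} [DecidableEq C] [DecidableEq S] [DecidableEq T] [LinearOrder T]

/-! Contracts are triples `(college, student, term)`.  For `x : C × S × T`,
`x.1` is the college, `x.2.1` the student and `x.2.2` the contract term.
The linear order on `T` plays the role of `▷`: higher terms are better for students. -/

variable (X : Finset (C × S × T))

/-- Admissible one-step extension of `A` by `a`. -/
def Ext (c : C) (Ch : Finset (C × S × T) → Finset (C × S × T))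
    (A : Finset (C × S × T)) (a : C × S × T) : Prop :=
  a ∈ Xc X c ∧ (∀ x ∈ Xc X c, x.2.1 = a.2.1 → a.2.2 < x.2.2 → x ∈ A) ∧
    ∀ y ∈ Ch A, y.2.1 ≠ a.2.1

theorem genMono_append (c : C) (L : List (C × S × T)) (a : C × S × T) :
    GenMono X c (L ++ [a]) ↔ GenMono X c L ∧
      (∀ x ∈ Xc X c, x.2.1 = a.2.1 → a.2.2 < x.2.2 → x ∈ L) := by
  constructor
  · intro h
    constructor
    · intro t ht x hx h1 h2
      have h3 := h t (by simp; omega) x hx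
      simp only [List.get_eq_getElem, List.getElem_append_left ht,
        List.take_append_of_le_length ht.le] at h3 h1 h2
      exact h3 h1 h2
    · intro x hx h1 h2
      have h3 := h L.length (by simp) x hx
      simp at h3
      exact h3 h1 h2
  · rintro ⟨h, h'⟩ t ht x hx
    by_cases hl : t < L.length
    · simp only [List.get_eq_getElem, List.getElem_append_left hl,
        List.take_append_of_le_length hl.le]
      exact h t hl x hx
    · have : t = L.length := by simp at ht; omega
      subst this
      simp
      exact h' x hx

theorem obsSeq_append (Ch : Finset (C × S × T) → Finset (C × S × T)) (hE : Ch ∅ = ∅)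
    (L : List (C × S × T)) (a : C × S × T) :
    ObsSeq Ch (L ++ [a]) ↔ ObsSeq Ch L ∧ ∀ y ∈ Ch L.toFinset, y.2.1 ≠ a.2.1 := by
  constructor
  · intro h
    constructor
    · intro t ht h0
      have h3 := h t (by simp; omega) h0
      simp only [List.get_eq_getElem, List.getElem_append_left ht,
        List.take_append_of_le_length ht.le] at h3
      exact h3
    · intro y hy hya
      by_cases h0 : 0 < L.length
      · have h3 := h L.length (by simp) h0
        rw [List.take_left] at h3
        apply h3
        rw [Finset.mem_image]
        exact ⟨y, hy, by simpa using hya⟩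
      · have : L = [] := by
          apply List.eq_nil_of_length_eq_zero; omega
        subst this
        rw [List.toFinset_nil, hE] at hy
        simp at hy
  · rintro ⟨h, h'⟩ t ht h0
    by_cases hl : t < L.length
    · simp only [List.get_eq_getElem, List.getElem_append_left hl,
        List.take_append_of_le_length hl.le]
      exact h t hl h0
    · have : t = L.length := by simp at ht; omega
      subst this
      rw [List.take_left]
      intro hm
      rw [Finset.mem_image] at hm
      obtain ⟨y, hy, hya⟩ := hm
      exact h' y hy (by simpa using hya)

theorem obsSet_empty (c : C) (Ch : Finset (C × S × T) → Finset (C × S × T)) :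
    ObsSet X c Ch ∅ := by
  refine ⟨[], List.nodup_nil, rfl, ?_, ?_, ?_⟩
  · intro x hx; simp at hx
  · intro t ht; simp at ht
  · intro t ht; simp at ht

theorem toFinset_snoc (L : List (C × S × T)) (a : C × S × T) :
    (L ++ [a]).toFinset = insert a L.toFinset := by
  ext x; simp [or_comm]

theorem obsSet_insert (c : C) (Ch : Finset (C × S × T) → Finset (C × S × T))
    (hE : Ch ∅ = ∅) (A : Finset (C × S × T)) (a : C × S × T)
    (hA : ObsSet X c Ch A) (ha : a ∉ A) (he : Ext X c Ch A a) :
    ObsSet X c Ch (insert a A) := by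
  obtain ⟨L, hn, rfl, hs, hg, ho⟩ := hA
  refine ⟨L ++ [a], ?_, toFinset_snoc L a, ?_, ?_, ?_⟩
  · rw [List.nodup_append]
    refine ⟨hn, List.nodup_singleton a, ?_⟩
    intro x hx y hy hxy
    simp at hy ha
    subst hy hxy
    exact ha hx
  · intro x hx
    rw [List.mem_append, List.mem_singleton] at hx
    rcases hx with hx | rfl
    · exact hs x hx
    · exact he.1
  · rw [genMono_append]
    exact ⟨hg, fun x hx h1 h2 => List.mem_toFinset.1 (he.2.1 x hx h1 h2)⟩
  · rw [obsSeq_append Ch hE]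
    exact ⟨ho, he.2.2⟩

theorem obsSet_induction (c : C) (Ch : Finset (C × S × T) → Finset (C × S × T))
    (hE : Ch ∅ = ∅) (P : Finset (C × S × T) → Prop) (h0 : P ∅)
    (h1 : ∀ A a, ObsSet X c Ch A → a ∉ A → Ext X c Ch A a → P A → P (insert a A))
    (A : Finset (C × S × T)) (hA : ObsSet X c Ch A) : P A := by
  obtain ⟨L, hn, rfl, hs, hg, ho⟩ := hA
  induction L using List.reverseRecOn with
  | nil => exact h0
  | append_singleton L a ih =>
    rw [genMono_append] at hg
    rw [obsSeq_append Ch hE] at ho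
    rw [List.nodup_append] at hn
    have hs' : SeqIn X c L := fun x hx => hs x (by simp [hx])
    rw [toFinset_snoc]
    refine h1 _ _ ⟨L, hn.1, rfl, hs', hg.1, ho.1⟩ ?_ ?_ (ih hn.1 hs' hg.1 ho.1)
    · intro hm
      exact hn.2.2 a (List.mem_toFinset.1 hm) a (by simp) rfl
    · exact ⟨hs a (by simp), fun x hx h1 h2 => List.mem_toFinset.2 (hg.2 x hx h1 h2), ho.2⟩

theorem rej_insert (c : C) (Ch : Finset (C × S × T) → Finset (C × S × T))
    (hE : Ch ∅ = ∅) (hobs : ObsSub X c Ch) (A : Finset (C × S × T)) (a : C × S × T)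
    (hA : ObsSet X c Ch A) (he : Ext X c Ch A a) :
    Rej Ch A ⊆ Rej Ch (insert a A) := by
  obtain ⟨L, hn, rfl, hs, hg, ho⟩ := hA
  have := hobs (L ++ [a]) ?_ ?_ ?_ L.length (by simp)
  · rw [List.take_left, List.take_of_length_le (by simp), toFinset_snoc] at this
    exact this
  · intro x hx
    rw [List.mem_append, List.mem_singleton] at hx
    rcases hx with hx | rfl
    · exact hs x hx
    · exact he.1
  · rw [genMono_append]
    exact ⟨hg, fun x hx h1 h2 => List.mem_toFinset.1 (he.2.1 x hx h1 h2)⟩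
  · rw [obsSeq_append Ch hE]
    exact ⟨ho, he.2.2⟩

theorem obsSet_sub (c : C) (Ch : Finset (C × S × T) → Finset (C × S × T))
    (A : Finset (C × S × T)) (hA : ObsSet X c Ch A) : A ⊆ Xc X c := by
  obtain ⟨L, hn, rfl, hs, hg, ho⟩ := hA
  intro x hx
  exact hs x (List.mem_toFinset.1 hx)

theorem obsSet_upper (c : C) (Ch : Finset (C × S × T) → Finset (C × S × T))
    (hE : Ch ∅ = ∅) (A : Finset (C × S × T)) (hA : ObsSet X c Ch A) :
    ∀ y ∈ A, ∀ x ∈ Xc X c, x.2.1 = y.2.1 → y.2.2 < x.2.2 → x ∈ A := by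
  refine obsSet_induction X c Ch hE
    (fun A => ∀ y ∈ A, ∀ x ∈ Xc X c, x.2.1 = y.2.1 → y.2.2 < x.2.2 → x ∈ A) ?_ ?_ A hA
  · intro y hy; simp at hy
  · intro A a _ _ he ih y hy x hx h1 h2
    rw [Finset.mem_insert] at hy ⊢
    right
    rcases hy with rfl | hy
    · exact he.2.1 x hx h1 h2
    · exact ih y hy x hx h1 h2

theorem first_exit (c : C) (Ch : Finset (C × S × T) → Finset (C × S × T))
    (hE : Ch ∅ = ∅) (B : Finset (C × S × T)) (A : Finset (C × S × T))
    (hA : ObsSet X c Ch A) (hAB : ¬ A ⊆ B) :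
    ∃ A' a, ObsSet X c Ch A' ∧ A' ⊆ B ∧ a ∈ A ∧ a ∉ B ∧ Ext X c Ch A' a := by
  revert hAB
  refine obsSet_induction X c Ch hE (fun A => ¬ A ⊆ B →
    ∃ A' a, ObsSet X c Ch A' ∧ A' ⊆ B ∧ a ∈ A ∧ a ∉ B ∧ Ext X c Ch A' a) ?_ ?_ A hA
  · intro h; exact absurd (Finset.empty_subset B) h
  · intro A a hA _ he ih h
    by_cases hAB : A ⊆ B
    · refine ⟨A, a, hA, hAB, Finset.mem_insert_self a A, ?_, he⟩
      intro haB
      exact h (Finset.insert_subset haB hAB)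
    · obtain ⟨A', b, h1, h2, h3, h4, h5⟩ := ih hAB
      exact ⟨A', b, h1, h2, Finset.mem_insert_of_mem h3, h4, h5⟩

theorem ext_transfer (c : C) (Ch : Finset (C × S × T) → Finset (C × S × T))
    (hCh : IsChoice X c Ch) (hE : Ch ∅ = ∅) (A B : Finset (C × S × T)) (a : C × S × T)
    (hB : ObsSet X c Ch B) (hAB : A ⊆ B) (haB : a ∉ B) (he : Ext X c Ch A a)
    (hR : Rej Ch A ⊆ Rej Ch B) : Ext X c Ch B a := by
  refine ⟨he.1, fun x hx h1 h2 => hAB (he.2.1 x hx h1 h2), ?_⟩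
  intro z hz hza
  have hBX := obsSet_sub X c Ch B hB
  have hzB : z ∈ B := hCh.1 B hBX hz
  have hzX := hBX hzB
  have hzA : z ∈ A := by
    rcases lt_trichotomy z.2.2 a.2.2 with h | h | h
    · exact absurd (obsSet_upper X c Ch hE B hB z hzB a he.1 hza.symm h) haB
    · exfalso
      apply haB
      have h1 : z.1 = c := (Finset.mem_filter.1 hzX).2
      have h2 : a.1 = c := (Finset.mem_filter.1 he.1).2
      have : z = a := Prod.ext (h1.trans h2.symm) (Prod.ext hza h)
      rwa [← this]
    · exact he.2.1 z hzX hza h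
  have hzR : z ∈ Rej Ch A := Finset.mem_sdiff.2 ⟨hzA, fun h => he.2.2 z h hza⟩
  exact (Finset.mem_sdiff.1 (hR hzR)).2 hz

theorem rej_mono (c : C) (Ch : Finset (C × S × T) → Finset (C × S × T))
    (hCh : IsChoice X c Ch) (hE : Ch ∅ = ∅) (hobs : ObsSub X c Ch) :
    ∀ n : ℕ, ∀ A, A.card = n → ObsSet X c Ch A → ∀ k : ℕ, ∀ B, (A \ B).card = k →
      ObsSet X c Ch B → B ⊆ A → Rej Ch B ⊆ Rej Ch A := by
  intro n
  induction n using Nat.strong_induction_on with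
  | _ n ihn =>
  intro A hn hA k
  induction k using Nat.strong_induction_on with
  | _ k ihk =>
  intro B hk hB hBA
  by_cases hAB : A ⊆ B
  · rw [Finset.Subset.antisymm hBA hAB]
  · obtain ⟨A', a, h1, h2, h3, h4, h5⟩ := first_exit X c Ch hE B A hA hAB
    have hlt : B.card < n := hn ▸ Finset.card_lt_card ⟨hBA, hAB⟩
    have hR := ihn B.card hlt B rfl hB _ A' rfl h1 h2
    have he := ext_transfer X c Ch hCh hE A' B a hB h2 h4 h5 hR
    refine (rej_insert X c Ch hE hobs B a hB he).trans ?_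
    refine ihk _ ?_ (insert a B) rfl (obsSet_insert X c Ch hE B a hB h4 he)
      (Finset.insert_subset h3 hBA)
    rw [← hk]
    apply Finset.card_lt_card
    rw [Finset.ssubset_iff_of_subset]
    · exact ⟨a, by simp [h3, h4], by simp⟩
    · intro x hx
      simp at hx ⊢
      tauto

theorem max_absorbs (c : C) (Ch : Finset (C × S × T) → Finset (C × S × T))
    (hCh : IsChoice X c Ch) (hE : Ch ∅ = ∅) (hobs : ObsSub X c Ch)
    (Y M Z : Finset (C × S × T)) (hM : MaxObsSubset X c Ch Y M)
    (hZ : ObsSet X c Ch Z) (hZY : Z ⊆ Y) : Z ⊆ M := by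
  by_contra h
  obtain ⟨hMY, hMo, hmax⟩ := hM
  obtain ⟨A', a, h1, h2, h3, h4, h5⟩ := first_exit X c Ch hE M Z hZ h
  have hR := rej_mono X c Ch hCh hE hobs _ M rfl hMo _ A' rfl h1 h2
  have he := ext_transfer X c Ch hCh hE A' M a hMo h2 h4 h5 hR
  have := hmax (insert a M) (obsSet_insert X c Ch hE M a hMo h4 he)
    (Finset.subset_insert a M) (Finset.insert_subset (hZY h3) hMY)
  exact h4 (this ▸ Finset.mem_insert_self a M)

/-- under observable substitutability every set of contracts of a
college has a unique maximal observable subset. -/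
theorem statement_4 [Fintype C] [Fintype S] [Fintype T]
    (X : Finset (C × S × T)) (c : C)
    (Ch : Finset (C × S × T) → Finset (C × S × T))
    (hCh : IsChoice X c Ch) (hobs : ObsSub X c Ch) :
    ∀ Y, Y ⊆ Xc X c → ∃! Ytil, MaxObsSubset X c Ch Y Ytil := by
  intro Y hY
  have hE : Ch ∅ = ∅ := Finset.subset_empty.1 (hCh.1 ∅ (Finset.empty_subset _))
  obtain ⟨M, hM, hmax⟩ := Finset.exists_max_image
    (Y.powerset.filter fun Z => ObsSet X c Ch Z) Finset.card
    ⟨∅, by simpa using obsSet_empty X c Ch⟩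
  rw [Finset.mem_filter, Finset.mem_powerset] at hM
  have hMM : MaxObsSubset X c Ch Y M := by
    refine ⟨hM.1, hM.2, ?_⟩
    intro Y' h1 h2 h3
    exact (Finset.eq_of_subset_of_card_le h2
      (hmax Y' (Finset.mem_filter.2 ⟨Finset.mem_powerset.2 h3, h1⟩))).symm
  refine ⟨M, hMM, ?_⟩
  intro N hN
  exact Finset.Subset.antisymm
    (max_absorbs X c Ch hCh hE hobs Y M N hMM hN.2.1 hN.1)
    (max_absorbs X c Ch hCh hE hobs Y N M hN hM.2 hM.1)

end MWC
end

section
/- Suppose contracts are observable substitutes for monotone preferences under Ch_c, and let Z ⊆ Y ⊆ X_c with Z̃ ⊆ Z and Ỹ ⊆ Y their unique maximal observable subsets under Ch_c. Then R_c(Z̃) ⊆ R_c(Ỹ). -/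
open scoped Classical

namespace MWC

variable {C S T : Type*} [DecidableEq C] [DecidableEq S] [DecidableEq T] [LinearOrder T]

/-! Contracts are triples `(college, student, term)`.  For `x : C × S × T`,
`x.1` is the college, `x.2.1` the student and `x.2.2` the contract term.
The linear order on `T` plays the role of `▷`: higher terms are better for students. -/

variable (X : Finset (C × S × T))

/-- `y` can be offered after the set `A` has been offered. -/
def Next (c : C) (Ch : Finset (C × S × T) → Finset (C × S × T))
    (A : Finset (C × S × T)) (y : C × S × T) : Prop :=
  y ∈ Xc X c ∧ (∀ x ∈ Xc X c, x.2.1 = y.2.1 → y.2.2 < x.2.2 → x ∈ A) ∧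
    ∀ x ∈ Ch A, x.2.1 ≠ y.2.1

theorem obs_upper {X : Finset (C × S × T)} {c : C}
    {Ch : Finset (C × S × T) → Finset (C × S × T)} {A : Finset (C × S × T)}
    (hA : ObsSet X c Ch A) : A ⊆ Xc X c ∧ ∀ y ∈ A, ∀ x ∈ Xc X c,
      x.2.1 = y.2.1 → y.2.2 < x.2.2 → x ∈ A := by
  obtain ⟨L, hn, rfl, hin, hg, ho⟩ := hA
  refine ⟨fun x hx => hin x (List.mem_toFinset.1 hx), ?_⟩
  intro y hy x hx hs ht
  obtain ⟨i, rfl⟩ := List.mem_iff_get.1 (List.mem_toFinset.1 hy)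
  exact List.mem_toFinset.2 (List.mem_of_mem_take (hg i.1 i.2 x hx hs ht))

theorem obs_snoc {X : Finset (C × S × T)} {c : C}
    {Ch : Finset (C × S × T) → Finset (C × S × T)} {A : Finset (C × S × T)}
    (hobs : ObsSub X c Ch) (hA : ObsSet X c Ch A) {y : C × S × T} (hyA : y ∉ A)
    (hy : Next X c Ch A y) :
    ObsSet X c Ch (insert y A) ∧ Rej Ch A ⊆ Rej Ch (insert y A) := by
  obtain ⟨L, hn, rfl, hin, hg, ho⟩ := hA
  obtain ⟨h1, h2, h3⟩ := hy
  have e : (L ++ [y]).toFinset = insert y L.toFinset := by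
    ext a; simp [or_comm]
  have k1 : SeqIn X c (L ++ [y]) := by
    intro x hx
    rcases List.mem_append.1 hx with h | h
    · exact hin x h
    · rw [List.mem_singleton.1 h]; exact h1
  have k2 : GenMono X c (L ++ [y]) := by
    intro t ht x hx hs hlt
    rcases Nat.lt_or_ge t L.length with h | h
    · have := hg t h x hx
      simp only [List.get_eq_getElem, List.getElem_append_left h] at hs hlt this
      rw [List.take_append_of_le_length h.le]
      exact this hs hlt
    · have ht' : t = L.length := by simp at ht; omega
      subst ht'
      simp at hs hlt
      have := h2 x hx hs hlt
      simpa using this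
  have k3 : ObsSeq Ch (L ++ [y]) := by
    intro t ht h0
    rcases Nat.lt_or_ge t L.length with h | h
    · have := ho t h h0
      simp only [List.get_eq_getElem, List.getElem_append_left h] at this ⊢
      rw [List.take_append_of_le_length h.le]
      exact this
    · have ht' : t = L.length := by simp at ht; omega
      subst ht'
      intro hm
      obtain ⟨z, hz, hzs⟩ := Finset.mem_image.1 hm
      rw [List.take_left] at hz
      simp at hzs
      exact h3 z hz hzs
  refine ⟨⟨L ++ [y], ?_, e, k1, k2, k3⟩, ?_⟩
  · rw [List.nodup_append]
    refine ⟨hn, by simp, ?_⟩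
    intro a ha b hb hab
    rw [List.mem_singleton.1 hb] at hab
    exact hyA (List.mem_toFinset.2 (hab ▸ ha))
  · have := hobs (L ++ [y]) k1 k2 k3 L.length (by simp)
    rw [List.take_left, List.take_of_length_le (by simp), e] at this
    exact this

theorem obs_unsnoc {X : Finset (C × S × T)} {c : C}
    {Ch : Finset (C × S × T) → Finset (C × S × T)} {A : Finset (C × S × T)}
    (hCh : IsChoice X c Ch) (hA : ObsSet X c Ch A) :
    A = ∅ ∨ ∃ A' y, A = insert y A' ∧ y ∉ A' ∧ ObsSet X c Ch A' ∧ Next X c Ch A' y := by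
  obtain ⟨L, hn, rfl, hin, hg, ho⟩ := hA
  rcases List.eq_nil_or_concat L with rfl | ⟨L, y, rfl⟩
  · left; rfl
  right
  rw [List.concat_eq_append] at *
  have hlt : L.length < (L ++ [y]).length := by simp
  have hn' := List.nodup_append.1 hn
  refine ⟨L.toFinset, y, ?_, ?_, ⟨L, hn'.1, rfl, ?_, ?_, ?_⟩, ?_, ?_, ?_⟩
  · ext a; simp [or_comm]
  · intro h
    exact hn'.2.2 y (List.mem_toFinset.1 h) y (by simp) rfl
  · intro x hx; exact hin x (by simp [hx])
  · intro t h x hx hs hl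
    have := hg t (h.trans hlt) x hx
    simp only [List.get_eq_getElem, List.getElem_append_left h] at hs hl this
    rw [List.take_append_of_le_length h.le] at this
    exact this hs hl
  · intro t h h0
    have := ho t (h.trans hlt) h0
    simp only [List.get_eq_getElem, List.getElem_append_left h] at this ⊢
    rw [List.take_append_of_le_length h.le] at this
    exact this
  · exact hin y (by simp)
  · intro x hx hs hl
    have := hg L.length hlt x hx
    rw [List.take_left] at this
    simp at this
    simpa using this hs hl
  · intro x hx hs
    rcases Nat.eq_zero_or_pos L.length with h | h
    · have : L = [] := List.length_eq_zero_iff.1 h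
      subst this
      have := hCh.1 _ (by simp) hx
      simp at this
    · have := ho L.length hlt h
      rw [List.take_left] at this
      apply this
      refine Finset.mem_image.2 ⟨x, hx, ?_⟩
      simpa using hs

theorem obs_step {X : Finset (C × S × T)} {c : C}
    {Ch : Finset (C × S × T) → Finset (C × S × T)} {W B : Finset (C × S × T)}
    (hCh : IsChoice X c Ch) (hobs : ObsSub X c Ch) (hW : ObsSet X c Ch W)
    (hBW : B ⊆ W) (hR : Rej Ch B ⊆ Rej Ch W) {y : C × S × T}
    (hy : Next X c Ch B y) :
    ObsSet X c Ch (insert y W) ∧ Rej Ch W ⊆ Rej Ch (insert y W) := by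
  by_cases hyW : y ∈ W
  · rw [Finset.insert_eq_of_mem hyW]; exact ⟨hW, subset_rfl⟩
  obtain ⟨h1, h2, h3⟩ := hy
  obtain ⟨u1, u2⟩ := obs_upper hW
  refine obs_snoc hobs hW hyW ⟨h1, fun x hx hs hl => hBW (h2 x hx hs hl), ?_⟩
  intro x hx hs
  have hxW : x ∈ W := hCh.1 W u1 hx
  have hxX := u1 hxW
  have hxB : x ∈ B := by
    rcases lt_trichotomy y.2.2 x.2.2 with h | h | h
    · exact h2 x hxX hs h
    · exfalso
      have e1 : x.1 = c := (Finset.mem_filter.1 hxX).2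
      have e2 : y.1 = c := (Finset.mem_filter.1 h1).2
      have : y = x := Prod.ext (e2.trans e1.symm) (Prod.ext hs.symm h)
      exact hyW (this ▸ hxW)
    · exact absurd (u2 x hxW y h1 hs.symm h) hyW
  have : x ∈ Rej Ch B := Finset.mem_sdiff.2 ⟨hxB, fun h => h3 x h hs⟩
  exact (Finset.mem_sdiff.1 (hR this)).2 hx

theorem obs_union {X : Finset (C × S × T)} {c : C}
    {Ch : Finset (C × S × T) → Finset (C × S × T)}
    (hCh : IsChoice X c Ch) (hobs : ObsSub X c Ch) (n : ℕ) :
    ∀ A B : Finset (C × S × T), ObsSet X c Ch A → ObsSet X c Ch B → A.card + B.card ≤ n →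
      ObsSet X c Ch (A ∪ B) ∧ Rej Ch A ⊆ Rej Ch (A ∪ B) ∧ Rej Ch B ⊆ Rej Ch (A ∪ B) := by
  induction n with
  | zero =>
    intro A B hA hB h
    have a0 : A = ∅ := Finset.card_eq_zero.1 (by omega)
    have b0 : B = ∅ := Finset.card_eq_zero.1 (by omega)
    subst a0; subst b0
    simpa using hA
  | succ n ih =>
    intro A B hA hB h
    rcases obs_unsnoc hCh hA with rfl | ⟨A', a, rfl, ha, hA', na⟩
    · rw [Finset.empty_union]
      exact ⟨hB, by simp [Rej], subset_rfl⟩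
    rcases obs_unsnoc hCh hB with rfl | ⟨B', b, rfl, hb, hB', nb⟩
    · rw [Finset.union_empty]
      exact ⟨hA, subset_rfl, by simp [Rej]⟩
    rw [Finset.card_insert_of_notMem ha, Finset.card_insert_of_notMem hb] at h
    obtain ⟨p1, p2, p3⟩ := ih _ _ hA hB' (by rw [Finset.card_insert_of_notMem ha]; omega)
    obtain ⟨q1, q2, q3⟩ := ih _ _ hA' hB (by rw [Finset.card_insert_of_notMem hb]; omega)
    obtain ⟨r1, r2⟩ := obs_step hCh hobs p1 Finset.subset_union_right p3 nb
    obtain ⟨s1, s2⟩ := obs_step hCh hobs q1 Finset.subset_union_left q2 na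
    rw [← Finset.union_insert] at r1 r2
    rw [← Finset.insert_union] at s1 s2
    exact ⟨r1, p2.trans r2, q3.trans s2⟩

/-- under observable substitutability, rejections from maximal
observable subsets are monotone with respect to set inclusion. -/
theorem statement_5 [Fintype C] [Fintype S] [Fintype T]
    (X : Finset (C × S × T)) (c : C)
    (Ch : Finset (C × S × T) → Finset (C × S × T))
    (hCh : IsChoice X c Ch) (hobs : ObsSub X c Ch)
    (Z Y Ztil Ytil : Finset (C × S × T))
    (hZY : Z ⊆ Y) (hY : Y ⊆ Xc X c)
    (hZt : MaxObsSubset X c Ch Z Ztil)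
    (hYt : MaxObsSubset X c Ch Y Ytil) :
    Rej Ch Ztil ⊆ Rej Ch Ytil := by
  obtain ⟨h1, h2, h3⟩ := obs_union hCh hobs _ Ytil Ztil hYt.2.1 hZt.2.1 le_rfl
  have := hYt.2.2 _ h1 Finset.subset_union_left
    (Finset.union_subset hYt.1 (hZt.1.trans hZY))
  rw [this] at h3
  exact h3

end MWC
end

section
/- Suppose contracts are observable substitutes for monotone preferences under Ch_c and Ch_c satisfies the observable law of aggregate demand for monotone preferences. Let Z ⊆ Y ⊆ X_c with Z̃ ⊆ Z and Ỹ ⊆ Y their unique maximal observable subsets under Ch_c. Then |Ch_c(Z̃)| ≤ |Ch_c(Ỹ)|. -/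
open scoped Classical

namespace MWC

variable {C S T : Type*} [DecidableEq C] [DecidableEq S] [DecidableEq T] [LinearOrder T]

/-! Contracts are triples `(college, student, term)`.  For `x : C × S × T`,
`x.1` is the college, `x.2.1` the student and `x.2.2` the contract term.
The linear order on `T` plays the role of `▷`: higher terms are better for students. -/

variable (X : Finset (C × S × T))

/-- `x` is a legal next proposal after the set of proposals `A`. -/
def Legal (c : C) (Ch : Finset (C × S × T) → Finset (C × S × T))
    (A : Finset (C × S × T)) (x : C × S × T) : Prop :=
  x ∈ Xc X c ∧ x ∉ A ∧ (∀ y ∈ Xc X c, y.2.1 = x.2.1 → x.2.2 < y.2.2 → y ∈ A) ∧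
    ∀ y ∈ Ch A, y.2.1 ≠ x.2.1

/-- One step of an observable sequence inside `Y`. -/
def OStep (c : C) (Ch : Finset (C × S × T) → Finset (C × S × T))
    (Y A B : Finset (C × S × T)) : Prop :=
  ObsSet X c Ch A ∧ ∃ x ∈ Y, Legal X c Ch A x ∧ B = insert x A

theorem gen_append (c : C) (Ch : Finset (C × S × T) → Finset (C × S × T))
    (L : List (C × S × T)) (x : C × S × T)
    (h2 : GenMono X c L) (h3 : ObsSeq Ch L)
    (h4 : Legal X c Ch L.toFinset x) :
    GenMono X c (L ++ [x]) ∧ ObsSeq Ch (L ++ [x]) := by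
  obtain ⟨hx, hxL, hup, hch⟩ := h4
  constructor
  · intro t ht y hy hys hyt
    rcases Nat.lt_or_ge t L.length with h | h
    · have e : (L ++ [x]).get ⟨t, ht⟩ = L.get ⟨t, h⟩ := by
        simp [List.getElem_append_left h]
      rw [e] at hys hyt
      rw [List.take_append_of_le_length h.le]
      exact h2 t h y hy hys hyt
    · have ht' : t = L.length := by simp at ht; omega
      subst ht'
      simp at hys hyt ⊢
      simpa using hup y hy hys hyt
  · intro t ht ht0
    rcases Nat.lt_or_ge t L.length with h | h
    · have e : (L ++ [x]).get ⟨t, ht⟩ = L.get ⟨t, h⟩ := by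
        simp [List.getElem_append_left h]
      rw [e, List.take_append_of_le_length h.le]
      exact h3 t h ht0
    · have ht' : t = L.length := by simp at ht; omega
      subst ht'
      rw [List.take_left]
      intro hmem
      obtain ⟨y, hy, hyx⟩ := Finset.mem_image.1 hmem
      refine hch y hy ?_
      simpa using hyx

theorem gen_prefix (c : C) (Ch : Finset (C × S × T) → Finset (C × S × T))
    (h0 : Ch ∅ = ∅)
    (L : List (C × S × T)) (x : C × S × T) (hnd : (L ++ [x]).Nodup)
    (h1 : SeqIn X c (L ++ [x])) (h2 : GenMono X c (L ++ [x])) (h3 : ObsSeq Ch (L ++ [x])) :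
    GenMono X c L ∧ ObsSeq Ch L ∧ Legal X c Ch L.toFinset x := by
  refine ⟨?_, ?_, ?_, ?_, ?_, ?_⟩
  · intro t ht y hy hys hyt
    have e : (L ++ [x]).get ⟨t, by simp; omega⟩ = L.get ⟨t, ht⟩ := by
      simp [List.getElem_append_left ht]
    have := h2 t (by simp; omega) y hy (by rw [e]; exact hys) (by rw [e]; exact hyt)
    rwa [List.take_append_of_le_length ht.le] at this
  · intro t ht ht0
    have e : (L ++ [x]).get ⟨t, by simp; omega⟩ = L.get ⟨t, ht⟩ := by
      simp [List.getElem_append_left ht]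
    have := h3 t (by simp; omega) ht0
    rwa [e, List.take_append_of_le_length ht.le] at this
  · exact h1 x (by simp)
  · intro hx
    rw [List.mem_toFinset] at hx
    rw [List.nodup_append] at hnd
    exact hnd.2.2 x hx x (by simp) rfl
  · intro y hy hys hyt
    have := h2 L.length (by simp) y hy (by simpa using hys) (by simpa using hyt)
    rw [List.take_left] at this
    exact List.mem_toFinset.2 this
  · intro y hy hyx
    rcases Nat.eq_zero_or_pos L.length with h | h
    · have hL : L = [] := List.length_eq_zero_iff.1 h
      subst hL
      rw [List.toFinset_nil, h0] at hy
      simp at hy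
    · have := h3 L.length (by simp) h
      rw [List.take_left] at this
      exact this (Finset.mem_image.2 ⟨y, hy, by simpa using hyx⟩)

theorem step_facts (c : C) (Ch : Finset (C × S × T) → Finset (C × S × T))
    (hobs : ObsSub X c Ch) (hlad : ObsLAD X c Ch)
    (A : Finset (C × S × T)) (hA : ObsSet X c Ch A) (x : C × S × T)
    (hx : Legal X c Ch A x) :
    ObsSet X c Ch (insert x A) ∧ Rej Ch A ⊆ Rej Ch (insert x A) ∧
      (Ch A).card ≤ (Ch (insert x A)).card := by
  obtain ⟨L, hnd, rfl, h1, h2, h3⟩ := hA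
  obtain ⟨g2, g3⟩ := gen_append X c Ch L x h2 h3 hx
  have g1 : SeqIn X c (L ++ [x]) := by
    intro y hy
    rcases List.mem_append.1 hy with h | h
    · exact h1 y h
    · rw [List.mem_singleton.1 h]; exact hx.1
  have e : (L ++ [x]).toFinset = insert x L.toFinset := by
    ext y; simp [or_comm]
  have e1 : (L ++ [x]).take (L.length + 1) = L ++ [x] :=
    List.take_of_length_le (by simp)
  have k1 := hobs _ g1 g2 g3 L.length (by simp)
  have k2 := hlad _ g1 g2 g3 L.length (by simp)
  rw [e1, List.take_left, e] at k1 k2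
  refine ⟨⟨L ++ [x], ?_, e, g1, g2, g3⟩, k1, k2⟩
  rw [List.nodup_append]
  refine ⟨hnd, by simp, ?_⟩
  rintro a ha b hb rfl
  rw [List.mem_singleton.1 hb] at ha
  exact hx.2.1 (List.mem_toFinset.2 ha)

theorem reach (c : C) (Ch : Finset (C × S × T) → Finset (C × S × T))
    (h0 : Ch ∅ = ∅) (Y : Finset (C × S × T))
    (L : List (C × S × T)) (hnd : L.Nodup) (hLY : L.toFinset ⊆ Y)
    (h1 : SeqIn X c L) (h2 : GenMono X c L) (h3 : ObsSeq Ch L) :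
    Relation.ReflTransGen (OStep X c Ch Y) ∅ L.toFinset := by
  induction L using List.reverseRecOn with
  | nil => exact Relation.ReflTransGen.refl
  | append_singleton L x ih =>
    obtain ⟨g2, g3, hl⟩ := gen_prefix X c Ch h0 L x hnd h1 h2 h3
    have e : (L ++ [x]).toFinset = insert x L.toFinset := by
      ext y; simp [or_comm]
    rw [e] at hLY ⊢
    have g1 : SeqIn X c L := fun y hy => h1 y (by simp [hy])
    have gn : L.Nodup := (List.nodup_append.1 hnd).1
    refine (ih gn (fun y hy => hLY (Finset.mem_insert_of_mem hy)) g1 g2 g3).tail ?_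
    exact ⟨⟨L, gn, rfl, g1, g2, g3⟩, x, hLY (Finset.mem_insert_self _ _), hl, rfl⟩

theorem legal_after (c : C) (Ch : Finset (C × S × T) → Finset (C × S × T))
    (hCh : IsChoice X c Ch) (hobs : ObsSub X c Ch) (hlad : ObsLAD X c Ch)
    (A : Finset (C × S × T)) (hA : ObsSet X c Ch A) (x y : C × S × T)
    (hx : Legal X c Ch A x) (hy : Legal X c Ch A y) (hxy : x ≠ y) :
    Legal X c Ch (insert x A) y := by
  have hs : x.2.1 ≠ y.2.1 := by
    intro hs
    rcases lt_trichotomy x.2.2 y.2.2 with h | h | h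
    · exact hy.2.1 (hx.2.2.1 y hy.1 hs.symm h)
    · have a := (Finset.mem_filter.1 hx.1).2
      have b := (Finset.mem_filter.1 hy.1).2
      exact hxy (Prod.ext (a.trans b.symm) (Prod.ext hs h))
    · exact hx.2.1 (hy.2.2.1 x hx.1 hs h)
  obtain ⟨-, hr, -⟩ := step_facts X c Ch hobs hlad A hA x hx
  have hAX : A ⊆ Xc X c := by
    obtain ⟨L, -, rfl, h1, -, -⟩ := hA
    intro z hz
    exact h1 z (List.mem_toFinset.1 hz)
  have hiX : insert x A ⊆ Xc X c := by
    intro z hz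
    rcases Finset.mem_insert.1 hz with rfl | h
    · exact hx.1
    · exact hAX h
  refine ⟨hy.1, ?_, ?_, ?_⟩
  · intro h
    rcases Finset.mem_insert.1 h with h | h
    · exact hxy h.symm
    · exact hy.2.1 h
  · intro z hz h1 h2
    exact Finset.mem_insert_of_mem (hy.2.2.1 z hz h1 h2)
  · intro z hz hzy
    rcases Finset.mem_insert.1 (hCh.1 _ hiX hz) with rfl | h
    · exact hs hzy
    · have hzr : z ∈ Rej Ch A := Finset.mem_sdiff.2 ⟨h, fun hc => hy.2.2.2 z hc hzy⟩
      exact (Finset.mem_sdiff.1 (hr hzr)).2 hz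

/-- under observable substitutability and the observable law of
aggregate demand, the number of chosen contracts from maximal observable subsets
is monotone with respect to set inclusion. -/
theorem statement_6 [Fintype C] [Fintype S] [Fintype T]
    (X : Finset (C × S × T)) (c : C)
    (Ch : Finset (C × S × T) → Finset (C × S × T))
    (hCh : IsChoice X c Ch) (hobs : ObsSub X c Ch) (hlad : ObsLAD X c Ch)
    (Z Y Ztil Ytil : Finset (C × S × T))
    (hZY : Z ⊆ Y) (hY : Y ⊆ Xc X c)
    (hZt : MaxObsSubset X c Ch Z Ztil)
    (hYt : MaxObsSubset X c Ch Y Ytil) :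
    (Ch Ztil).card ≤ (Ch Ytil).card := by
  have h0 : Ch ∅ = ∅ := Finset.subset_empty.1 (hCh.1 ∅ (Finset.empty_subset _))
  have rZ : Relation.ReflTransGen (OStep X c Ch Y) ∅ Ztil := by
    obtain ⟨hs, ⟨L, hnd, rfl, h1, h2, h3⟩, -⟩ := hZt
    exact reach X c Ch h0 Y L hnd (hs.trans hZY) h1 h2 h3
  have rY : Relation.ReflTransGen (OStep X c Ch Y) ∅ Ytil := by
    obtain ⟨hs, ⟨L, hnd, rfl, h1, h2, h3⟩, -⟩ := hYt
    exact reach X c Ch h0 Y L hnd hs h1 h2 h3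
  have key : ∀ {A B : Finset (C × S × T)}, Relation.ReflTransGen (OStep X c Ch Y) A B →
      ObsSet X c Ch A → A ⊆ Y →
      A ⊆ B ∧ B ⊆ Y ∧ ObsSet X c Ch B ∧ (Ch A).card ≤ (Ch B).card := by
    intro A B h hA hAY
    induction h with
    | refl => exact ⟨subset_rfl, hAY, hA, le_rfl⟩
    | tail _ hst ih =>
      obtain ⟨i1, i2, i3, i4⟩ := ih
      obtain ⟨-, x, hxY, hx, rfl⟩ := hst
      obtain ⟨k1, -, k3⟩ := step_facts X c Ch hobs hlad _ i3 x hx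
      exact ⟨i1.trans (Finset.subset_insert _ _), Finset.insert_subset hxY i2, k1, i4.trans k3⟩
  obtain ⟨D, hZD, hYD⟩ := Relation.church_rosser (r := OStep X c Ch Y) (by
    rintro A B D ⟨hA, x, hxY, hx, rfl⟩ ⟨-, y, hyY, hy, rfl⟩
    by_cases hxy : x = y
    · subst hxy
      exact ⟨_, Relation.ReflGen.refl, Relation.ReflTransGen.refl⟩
    · refine ⟨insert y (insert x A), Relation.ReflGen.single ?_, Relation.ReflTransGen.single ?_⟩
      · exact ⟨(step_facts X c Ch hobs hlad A hA x hx).1, y, hyY,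
          legal_after X c Ch hCh hobs hlad A hA x y hx hy hxy, rfl⟩
      · exact ⟨(step_facts X c Ch hobs hlad A hA y hy).1, x, hxY,
          legal_after X c Ch hCh hobs hlad A hA y x hy hx (Ne.symm hxy),
          Finset.insert_comm _ _ _⟩) rZ rY
  obtain ⟨a1, a2, a3, -⟩ := key hYD hYt.2.1 hYt.1
  have hD : D = Ytil := hYt.2.2 D a3 a1 a2
  subst hD
  exact (key hZD hZt.2.1 (hZt.1.trans hZY)).2.2.2

end MWC
end
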